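/- arXiv:2104.14705 — 2 statements merged into one kernel-verified Lean document; each statement's English description precedes it below -/
import Mathlib

section
/- For all x, y ∈ ℂ with x ∉ Λ, y ∉ Λ and x+y ∉ Λ, one has ( (log θ₁)'(x|τ) + (log θ₁)'(y|τ) − (log θ₁)'(x+y|τ) )² = ℘(x|τ) + ℘(y|τ) + ℘(x+y|τ), where (log θ₁)'(z|τ) denotes the logarithmic derivative (∂θ₁/∂z)(z|τ)/θ₁(z|τ). -/
noncomputable section

open Complex

namespace Liu

/-- `π` as a complex number. -/
def piC : ℂ := Real.pi

/-- The nome `q = exp(2πiτ)`. -/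
def qq (τ : ℂ) : ℂ := exp (2 * piC * I * τ)

/-- Jacobi theta function θ₁(z|τ). -/
def theta1 (z τ : ℂ) : ℂ :=
  -I * exp (piC * I * τ / 4) *
    ∑' n : ℤ, (-1 : ℂ) ^ n * exp (piC * I * τ * (n : ℂ) * ((n : ℂ) + 1)) *
      exp ((2 * (n : ℂ) + 1) * I * z)

/-- Jacobi theta function θ₂(z|τ). -/
def theta2 (z τ : ℂ) : ℂ :=
  2 * ∑' n : ℕ, exp (piC * I * τ * (2 * (n : ℂ) + 1) ^ 2 / 4) * cos ((2 * (n : ℂ) + 1) * z)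

/-- Jacobi theta function θ₃(z|τ). -/
def theta3 (z τ : ℂ) : ℂ :=
  1 + 2 * ∑' n : ℕ, exp (piC * I * τ * ((n : ℂ) + 1) ^ 2) * cos (2 * ((n : ℂ) + 1) * z)

/-- Jacobi theta function θ₄(z|τ). -/
def theta4 (z τ : ℂ) : ℂ :=
  1 + 2 * ∑' n : ℕ, (-1 : ℂ) ^ (n + 1) * exp (piC * I * τ * ((n : ℂ) + 1) ^ 2) *
    cos (2 * ((n : ℂ) + 1) * z)

/-- θ₁'(τ) = (∂θ₁/∂z)(0|τ). -/
def theta1' (τ : ℂ) : ℂ := deriv (fun z => theta1 z τ) 0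

/-- The Dedekind eta function. -/
def eta (τ : ℂ) : ℂ := exp (piC * I * τ / 12) * ∏' n : ℕ, (1 - qq τ ^ (n + 1))

/-- Eisenstein series L = E₂. -/
def EisL (τ : ℂ) : ℂ :=
  1 - 24 * ∑' n : ℕ, ((n : ℂ) + 1) * qq τ ^ (n + 1) / (1 - qq τ ^ (n + 1))

/-- Eisenstein series M = E₄. -/
def EisM (τ : ℂ) : ℂ :=
  1 + 240 * ∑' n : ℕ, ((n : ℂ) + 1) ^ 3 * qq τ ^ (n + 1) / (1 - qq τ ^ (n + 1))

/-- The period lattice Λ = {mπ + nπτ : m, n ∈ ℤ}. -/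
def Lambda (τ : ℂ) : Set ℂ := {z | ∃ m n : ℤ, z = (m : ℂ) * piC + (n : ℂ) * piC * τ}

/-- The Weierstrass ℘ function attached to the lattice with periods π and πτ. -/
def wp (τ z : ℂ) : ℂ :=
  1 / z ^ 2 + ∑' p : ℤ × ℤ,
    if p = (0, 0) then 0
    else 1 / (z - ((p.1 : ℂ) * piC + (p.2 : ℂ) * piC * τ)) ^ 2
      - 1 / ((p.1 : ℂ) * piC + (p.2 : ℂ) * piC * τ) ^ 2

open Filter Topology

/-- `f` agrees near `x`, except possibly at `x`, with a function analytic at `x`. -/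
def RemovableAt (f : ℂ → ℂ) (x : ℂ) : Prop :=
  ∃ g : ℂ → ℂ, AnalyticAt ℂ g x ∧ f =ᶠ[𝓝[≠] x] g

/-- `f` has period `l` away from a discrete closed set. -/
def GenericallyPeriodic (f : ℂ → ℂ) (l : ℂ) : Prop :=
  ∀ x, ∀ᶠ z in 𝓝[≠] x, f (z + l) = f z

lemma tendsto_add_punctured (x l : ℂ) : Tendsto (fun z => z + l) (𝓝[≠] x) (𝓝[≠] (x + l)) := by
  refine tendsto_nhdsWithin_iff.2 ⟨?_, ?_⟩
  · exact ((continuous_add_const l).tendsto x).mono_left nhdsWithin_le_nhds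
  · filter_upwards [self_mem_nhdsWithin] with z hz
    simpa using hz

lemma RemovableAt.of_add {f : ℂ → ℂ} {x l : ℂ} (hl : GenericallyPeriodic f l)
    (h : RemovableAt f (x + l)) : RemovableAt f x := by
  obtain ⟨g, hg, hfg⟩ := h
  refine ⟨fun z => g (z + l), AnalyticAt.comp (g := g) (f := fun z => z + l) hg (by fun_prop), ?_⟩
  filter_upwards [hl x, (tendsto_add_punctured x l).eventually hfg] with z h1 h2
  rw [← h1, h2]

lemma removableAt_of_analyticAt {f : ℂ → ℂ} {x : ℂ} (h : AnalyticAt ℂ f x) : RemovableAt f x :=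
  ⟨f, h, EventuallyEq.rfl⟩

lemma GenericallyPeriodic.of_mem_lattice {L : PeriodPair} {f : ℂ → ℂ}
    (h₁ : GenericallyPeriodic f L.ω₁) (h₂ : GenericallyPeriodic f L.ω₂) {l : ℂ}
    (hl : l ∈ L.lattice) : GenericallyPeriodic f l := by
  let G : AddSubgroup ℂ :=
    { carrier := {l | GenericallyPeriodic f l}
      zero_mem' := fun x => by simp
      add_mem' := fun {a b} ha hb x => by
        filter_upwards [ha x, (tendsto_add_punctured x a).eventually (hb (x + a))] with z h1 h2
        rw [← add_assoc, h2, h1]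
      neg_mem' := fun {a} ha x => by
        filter_upwards [(tendsto_add_punctured x (-a)).eventually (ha (x + -a))] with z h1
        rw [← h1, neg_add_cancel_right] }
  have : L.lattice ≤ AddSubgroup.toIntSubmodule G := by
    refine Submodule.span_le.2 ?_
    rintro z (rfl | rfl)
    exacts [h₁, h₂]
  exact this hl

/-- Liouville's theorem for elliptic functions all of whose singularities are removable. -/
theorem exists_const_of_removableAt (L : PeriodPair) {f : ℂ → ℂ}
    (h₁ : GenericallyPeriodic f L.ω₁) (h₂ : GenericallyPeriodic f L.ω₂)
    (hf : ∀ x, ∃ l ∈ L.lattice, RemovableAt f (x + l)) :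
    ∃ c, ∀ x g, AnalyticAt ℂ g x → f =ᶠ[𝓝[≠] x] g → g x = c := by
  have hf' : ∀ x, RemovableAt f x := fun x => by
    obtain ⟨l, hl, h⟩ := hf x
    exact h.of_add (h₁.of_mem_lattice h₂ hl)
  choose g hg hfg using hf'
  have key : ∀ x k, AnalyticAt ℂ k x → f =ᶠ[𝓝[≠] x] k → k x = g x x := by
    intro x k hk hfk
    have h1 : Tendsto f (𝓝[≠] x) (𝓝 (k x)) :=
      (hk.continuousAt.tendsto.mono_left nhdsWithin_le_nhds).congr' hfk.symm
    have h2 : Tendsto f (𝓝[≠] x) (𝓝 (g x x)) :=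
      ((hg x).continuousAt.tendsto.mono_left nhdsWithin_le_nhds).congr' (hfg x).symm
    exact tendsto_nhds_unique h1 h2
  let F : ℂ → ℂ := fun x => g x x
  have hF : ∀ x, F =ᶠ[𝓝 x] g x := by
    intro x
    have h1 : ∀ᶠ y in 𝓝[≠] x, AnalyticAt ℂ (g x) y ∧ f =ᶠ[𝓝[≠] y] g x := by
      have ha := (hg x).eventually_analyticAt.filter_mono (nhdsWithin_le_nhds (s := {x}ᶜ))
      have hb := eventually_eventually_nhdsWithin.2 (hfg x)
      filter_upwards [ha, hb, self_mem_nhdsWithin] with y hy1 hy2 hy3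
      refine ⟨hy1, ?_⟩
      rw [IsOpen.nhdsWithin_eq isOpen_compl_singleton hy3] at hy2
      exact Filter.Eventually.filter_mono nhdsWithin_le_nhds hy2
    rw [eventually_nhdsWithin_iff] at h1
    filter_upwards [h1] with y hy
    by_cases hyx : y = x
    · subst hyx; rfl
    · exact (key y (g x) (hy hyx).1 (hy hyx).2).symm
  have hFd : Differentiable ℂ F := fun x => ((analyticAt_congr (hF x)).2 (hg x)).differentiableAt
  have hFp : ∀ z, ∀ l ∈ L.lattice, F (z + l) = F z := by
    intro z l hl
    refine key z (fun w => g (z + l) (w + l)) (AnalyticAt.comp (g := g (z + l))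
      (f := fun w => w + l) (hg _) (by fun_prop)) ?_
    filter_upwards [h₁.of_mem_lattice h₂ hl z,
      (tendsto_add_punctured z l).eventually (hfg (z + l))] with w hw1 hw2
    rw [← hw1, hw2]
  refine ⟨F 0, fun x k hk hfk => (key x k hk hfk).trans ?_⟩
  exact hFd.apply_eq_apply_of_bounded (IsZLattice.isCompact_range_of_periodic L.lattice _
    hFd.continuous hFp).isBounded x 0

lemma eventually_notMem_lattice (L : PeriodPair) (x : ℂ) : ∀ᶠ z in 𝓝[≠] x, z ∉ L.lattice := by
  filter_upwards [self_mem_nhdsWithin,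
    mem_nhdsWithin_of_mem_nhds (L.compl_lattice_sdiff_singleton_mem_nhds x)] with z h1 h2 h3
  exact h2 ⟨h3, h1⟩

lemma weierstrassP_eq (L : PeriodPair) (z : ℂ) :
    L.weierstrassP z = L.weierstrassPExcept 0 z + 1 / z ^ 2 := by
  have := L.weierstrassPExcept_add 0 z
  simpa using this.symm

lemma weierstrassPExcept_zero (L : PeriodPair) : L.weierstrassPExcept 0 0 = 0 := by
  simp [PeriodPair.weierstrassPExcept]

/-- The odd entire functions with simple zeros exactly at the points of a lattice and
exponential factors of automorphy. -/
structure IsSigmaLike (L : PeriodPair) (E : ℂ → ℂ) : Prop where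
  differentiable : Differentiable ℂ E
  odd : ∀ z, E (-z) = -E z
  deriv_zero_ne : deriv E 0 ≠ 0
  ne_zero : ∀ z ∉ L.lattice, E z ≠ 0
  quasi₁ : ∃ a b : ℂ, ∀ z, E (z + L.ω₁) = exp (a * z + b) * E z
  quasi₂ : ∃ a b : ℂ, ∀ z, E (z + L.ω₂) = exp (a * z + b) * E z

namespace IsSigmaLike

variable {L : PeriodPair} {E : ℂ → ℂ} (hE : IsSigmaLike L E)
include hE

lemma logDeriv_add {l a b : ℂ} (h : ∀ z, E (z + l) = exp (a * z + b) * E z) {z : ℂ}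
    (hz : z ∉ L.lattice) : logDeriv E (z + l) = logDeriv E z + a := by
  have h0 := hE.ne_zero z hz
  have hd := (hE.differentiable z).hasDerivAt
  have h1 : HasDerivAt (fun z => exp (a * z + b) * E z)
      (exp (a * z + b) * a * E z + exp (a * z + b) * deriv E z) z := by
    have : HasDerivAt (fun z => a * z + b) a z := by
      simpa using ((hasDerivAt_id z).const_mul a).add_const b
    exact this.cexp.mul hd
  have h2 : deriv E (z + l) = exp (a * z + b) * a * E z + exp (a * z + b) * deriv E z := by
    rw [← deriv_comp_add_const, funext h, h1.deriv]
  have he := exp_ne_zero (a * z + b)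
  rw [logDeriv_apply, logDeriv_apply, h2, h z]
  field_simp
  ring

lemma analyticAt_logDeriv {z : ℂ} (hz : z ∉ L.lattice) : AnalyticAt ℂ (logDeriv E) z := by
  have := hE.differentiable.analyticAt z
  exact this.deriv.div this (hE.ne_zero z hz)

lemma logDeriv_neg (z : ℂ) : logDeriv E (-z) = -logDeriv E z := by
  have h : deriv E (-z) = deriv E z := by
    have h1 := deriv_comp_neg E z
    have h2 : (fun x => E (-x)) = fun x => -E x := funext hE.odd
    rw [h2, deriv.fun_neg] at h1
    simpa using h1.symm
  rw [logDeriv_apply, logDeriv_apply, h, hE.odd, div_neg]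

lemma exists_logDeriv_eq : ∃ k : ℂ → ℂ, AnalyticAt ℂ k 0 ∧ k 0 = 0 ∧
    ∀ᶠ z in 𝓝[≠] 0, logDeriv E z = 1 / z + k z := by
  have hE0 : E 0 = 0 := by
    have := hE.odd 0
    rw [neg_zero] at this
    exact CharZero.eq_neg_self_iff.1 this
  let h := dslope E 0
  have hEh : ∀ z, E z = z * h z := fun z => by
    have := sub_smul_dslope E 0 z
    simp only [sub_zero, hE0, smul_eq_mul] at this
    exact this.symm
  have hh : Differentiable ℂ h := by
    intro z
    have : DifferentiableOn ℂ h Set.univ :=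
      (differentiableOn_dslope univ_mem).2 hE.differentiable.differentiableOn
    exact this.differentiableAt univ_mem
  have hh0 : h 0 ≠ 0 := by simpa [h] using hE.deriv_zero_ne
  have heven : ∀ z, h (-z) = h z := by
    intro z
    by_cases hz : z = 0
    · simp [hz]
    · have := hE.odd z
      rw [hEh, hEh] at this
      exact mul_left_cancel₀ hz (by linear_combination -this)
  have hd0 : deriv h 0 = 0 := by
    have h1 := deriv_comp_neg h 0
    rw [funext heven, neg_zero] at h1
    exact CharZero.eq_neg_self_iff.1 h1
  refine ⟨logDeriv h, ?_, ?_, ?_⟩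
  · exact (hh.analyticAt 0).deriv.div (hh.analyticAt 0) hh0
  · simp [logDeriv_apply, hd0]
  · filter_upwards [self_mem_nhdsWithin,
      mem_nhdsWithin_of_mem_nhds (hh.continuous.continuousAt.eventually_ne hh0)] with z hz hz'
    have : E = fun z => z * h z := funext hEh
    rw [this, logDeriv_mul (f := fun z => z) z hz hz' differentiableAt_fun_id (hh z), logDeriv_id']

lemma deriv_logDeriv_add {l a b : ℂ} (h : ∀ z, E (z + l) = exp (a * z + b) * E z) {z : ℂ}
    (hz : z ∉ L.lattice) : deriv (logDeriv E) (z + l) = deriv (logDeriv E) z := by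
  have h1 : (fun w => logDeriv E (w + l)) =ᶠ[𝓝 z] fun w => logDeriv E w + a := by
    filter_upwards [L.isClosed_lattice.isOpen_compl.mem_nhds hz] with w hw
    exact hE.logDeriv_add h hw
  rw [← deriv_comp_add_const, h1.deriv_eq, deriv_add_const]

/-- The derivative of the logarithmic derivative is `-℘` up to an additive constant. -/
theorem deriv_logDeriv_add_weierstrassP {k : ℂ → ℂ} (hk : AnalyticAt ℂ k 0)
    (hEk : ∀ᶠ z in 𝓝[≠] 0, logDeriv E z = 1 / z + k z) {y : ℂ} (hy : y ∉ L.lattice) :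
    deriv (logDeriv E) y + L.weierstrassP y = deriv k 0 := by
  let f : ℂ → ℂ := fun z => deriv (logDeriv E) z + L.weierstrassP z
  have hper : ∀ l ∈ L.lattice, (∃ a b : ℂ, ∀ z, E (z + l) = exp (a * z + b) * E z) →
      GenericallyPeriodic f l := by
    rintro l hl ⟨a, b, h⟩ x
    filter_upwards [eventually_notMem_lattice L x] with z hz
    simp only [f]
    rw [hE.deriv_logDeriv_add h hz, L.weierstrassP_add_coe z ⟨l, hl⟩]
  have han : ∀ z ∉ L.lattice, AnalyticAt ℂ f z := fun z hz =>
    (hE.analyticAt_logDeriv hz).deriv.add (L.analyticOnNhd_weierstrassP z hz)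
  let g : ℂ → ℂ := fun z => deriv k z + L.weierstrassPExcept 0 z
  have hg : AnalyticAt ℂ g 0 := hk.deriv.add (L.analyticAt_weierstrassPExcept 0)
  have hfg : f =ᶠ[𝓝[≠] 0] g := by
    have hb := eventually_eventually_nhdsWithin.2 hEk
    have hc := hk.eventually_analyticAt.filter_mono (nhdsWithin_le_nhds (s := {0}ᶜ))
    filter_upwards [hb, hc, self_mem_nhdsWithin] with z h1 h2 h3
    rw [IsOpen.nhdsWithin_eq isOpen_compl_singleton h3] at h1
    have hz : z ≠ 0 := h3
    have h4 : HasDerivAt (fun w : ℂ => 1 / w + k w) (-(z ^ 2)⁻¹ + deriv k z) z := by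
      simp only [one_div]
      exact (hasDerivAt_inv hz).add h2.differentiableAt.hasDerivAt
    have h5 : deriv (logDeriv E) z = -(z ^ 2)⁻¹ + deriv k z := by
      rw [Filter.EventuallyEq.deriv_eq h1, h4.deriv]
    simp only [f, g]
    rw [h5, weierstrassP_eq, one_div]
    ring
  obtain ⟨c, hc⟩ := exists_const_of_removableAt L (f := f) (hper _ L.ω₁_mem_lattice hE.quasi₁)
    (hper _ L.ω₂_mem_lattice hE.quasi₂) (fun x => by
      by_cases hx : x ∈ L.lattice
      · exact ⟨-x, neg_mem hx, by rw [add_neg_cancel]; exact ⟨g, hg, hfg⟩⟩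
      · exact ⟨0, zero_mem _, by rw [add_zero]; exact removableAt_of_analyticAt (han x hx)⟩)
  have h1 := hc y f (han y hy) EventuallyEq.rfl
  have h2 := hc 0 g hg hfg
  simp only [f] at h1
  simp only [g, weierstrassPExcept_zero, add_zero] at h2
  rw [h1, h2]

/-- The quadratic addition formula relating the logarithmic derivative to `℘`. -/
theorem logDeriv_add_logDeriv_sub_sq {x y : ℂ} (hx : x ∉ L.lattice) (hy : y ∉ L.lattice)
    (hxy : x + y ∉ L.lattice) :
    (logDeriv E x + logDeriv E y - logDeriv E (x + y)) ^ 2 =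
      L.weierstrassP x + L.weierstrassP y + L.weierstrassP (x + y) := by
  obtain ⟨k, hk, hk0, hEk⟩ := hE.exists_logDeriv_eq
  let f : ℂ → ℂ := fun z => (logDeriv E z + logDeriv E y - logDeriv E (z + y)) ^ 2 -
    (L.weierstrassP z + L.weierstrassP y + L.weierstrassP (z + y))
  have hper : ∀ l ∈ L.lattice, (∃ a b : ℂ, ∀ z, E (z + l) = exp (a * z + b) * E z) →
      GenericallyPeriodic f l := by
    rintro l hl ⟨a, b, h⟩ x
    filter_upwards [eventually_notMem_lattice L x,
      (tendsto_add_punctured x y).eventually (eventually_notMem_lattice L (x + y))] with z hz hz'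
    simp only [f]
    rw [add_right_comm z l y, hE.logDeriv_add h hz, hE.logDeriv_add h hz',
      L.weierstrassP_add_coe z ⟨l, hl⟩, L.weierstrassP_add_coe (z + y) ⟨l, hl⟩]
    ring
  have han : ∀ z ∉ L.lattice, z + y ∉ L.lattice → AnalyticAt ℂ f z := by
    intro z hz hzy
    have h1 := hE.analyticAt_logDeriv hz
    have h2 : AnalyticAt ℂ (fun z => logDeriv E (z + y)) z :=
      AnalyticAt.comp (g := logDeriv E) (f := fun z => z + y) (hE.analyticAt_logDeriv hzy)
        (by fun_prop)
    have h3 := L.analyticOnNhd_weierstrassP z hz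
    have h4 : AnalyticAt ℂ (fun z => L.weierstrassP (z + y)) z :=
      AnalyticAt.comp (g := L.weierstrassP) (f := fun z => z + y)
        (L.analyticOnNhd_weierstrassP _ hzy) (by fun_prop)
    exact (((h1.add analyticAt_const).sub h2).pow 2).sub ((h3.add analyticAt_const).add h4)
  have hsymm : ∀ z, f (-y - z) = f z := by
    intro z
    simp only [f]
    rw [show -y - z = -(z + y) by ring, show -(z + y) + y = -z by ring, hE.logDeriv_neg,
      hE.logDeriv_neg, L.weierstrassP_neg, L.weierstrassP_neg]
    ring
  let m : ℂ → ℂ := fun z => k z + logDeriv E y - logDeriv E (z + y)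
  have hy' : 0 + y ∉ L.lattice := by rwa [zero_add]
  have hshift : AnalyticAt ℂ (fun z => logDeriv E (z + y)) 0 :=
    AnalyticAt.comp (g := logDeriv E) (f := fun z => z + y) (hE.analyticAt_logDeriv hy')
        (by fun_prop)
  have hm : AnalyticAt ℂ m 0 := (hk.add analyticAt_const).sub hshift
  have hm0 : m 0 = 0 := by simp [m, hk0]
  have hdm : deriv m 0 = deriv k 0 - deriv (logDeriv E) y := by
    have h1 : HasDerivAt (fun z => logDeriv E (z + y)) (deriv (logDeriv E) y) 0 := by
      have := hshift.differentiableAt.hasDerivAt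
      rwa [deriv_comp_add_const, zero_add] at this
    exact ((hk.differentiableAt.hasDerivAt.add_const (logDeriv E y)).sub h1).deriv
  have hdslope : AnalyticAt ℂ (dslope m 0) 0 := by
    obtain ⟨p, hp⟩ := hm
    exact ⟨_, hp.has_fpower_series_dslope_fslope⟩
  let g : ℂ → ℂ := fun z => 2 * dslope m 0 z + m z ^ 2 -
    (L.weierstrassPExcept 0 z + L.weierstrassP y + L.weierstrassP (z + y))
  have hg : AnalyticAt ℂ g 0 := by
    have h4 : AnalyticAt ℂ (fun z => L.weierstrassP (z + y)) 0 :=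
      AnalyticAt.comp (g := L.weierstrassP) (f := fun z => z + y)
        (L.analyticOnNhd_weierstrassP _ hy') (by fun_prop)
    exact ((analyticAt_const.mul hdslope).add (hm.pow 2)).sub
      (((L.analyticAt_weierstrassPExcept 0).add analyticAt_const).add h4)
  have hfg : f =ᶠ[𝓝[≠] 0] g := by
    filter_upwards [hEk, self_mem_nhdsWithin] with z h1 h3
    have hz : z ≠ 0 := h3
    have h2 : m z = z * dslope m 0 z := by
      have := sub_smul_dslope m 0 z
      simp only [sub_zero, hm0, smul_eq_mul] at this
      exact this.symm
    have h4 : logDeriv E z + logDeriv E y - logDeriv E (z + y) = 1 / z + m z := by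
      rw [h1]; simp only [m]; ring
    simp only [f, g]
    rw [h4, weierstrassP_eq, h2]
    field_simp
    ring
  have hg' : AnalyticAt ℂ (fun z => g (-y - z)) (-y) :=
    AnalyticAt.comp (g := g) (f := fun z => -y - z) (by simpa using hg) (by fun_prop)
  have hfg' : f =ᶠ[𝓝[≠] (-y)] fun z => g (-y - z) := by
    have ht : Tendsto (fun z => -y - z) (𝓝[≠] (-y)) (𝓝[≠] 0) := by
      refine tendsto_nhdsWithin_iff.2 ⟨?_, ?_⟩
      · have : Tendsto (fun z => -y - z) (𝓝 (-y)) (𝓝 (-y - -y)) :=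
          (continuous_const.sub continuous_id).tendsto (-y)
        rw [sub_self] at this
        exact this.mono_left nhdsWithin_le_nhds
      · filter_upwards [self_mem_nhdsWithin] with z hz h0
        exact hz (sub_eq_zero.1 h0).symm
    filter_upwards [ht.eventually hfg] with z hz
    rw [← hsymm, hz]
  obtain ⟨c, hc⟩ := exists_const_of_removableAt L (f := f) (hper _ L.ω₁_mem_lattice hE.quasi₁)
    (hper _ L.ω₂_mem_lattice hE.quasi₂) (fun z => by
      by_cases hz : z ∈ L.lattice
      · exact ⟨-z, neg_mem hz, by rw [add_neg_cancel]; exact ⟨g, hg, hfg⟩⟩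
      by_cases hzy : z + y ∈ L.lattice
      · refine ⟨-(z + y), neg_mem hzy, ?_⟩
        rw [show z + -(z + y) = -y by ring]
        exact ⟨_, hg', hfg'⟩
      · exact ⟨0, zero_mem _, by rw [add_zero]; exact removableAt_of_analyticAt (han z hz hzy)⟩)
  have h1 := hc x f (han x hx hxy) EventuallyEq.rfl
  have h2 := hc 0 g hg hfg
  have h3 := hE.deriv_logDeriv_add_weierstrassP hk hEk hy
  have h4 : g 0 = 0 := by
    simp only [g, weierstrassPExcept_zero, hm0, dslope_same, hdm, zero_add]
    linear_combination -2 * h3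
  rw [h4] at h2
  rw [← h2] at h1
  exact sub_eq_zero.1 h1

end IsSigmaLike

/-- The infinite product `∏ (1 - qⁿ u)` over `n ≥ 0`. -/
def qProd (q u : ℂ) : ℂ := ∏' n : ℕ, (1 - q ^ n * u)

section QProd

variable {q : ℂ} (hq : ‖q‖ < 1)
include hq

lemma summable_norm_pow_mul (u : ℂ) : Summable fun n : ℕ => ‖-(q ^ n * u)‖ := by
  simpa [norm_mul] using (summable_geometric_of_lt_one (norm_nonneg q) hq).mul_right ‖u‖

lemma qProd_eq_mul (u : ℂ) : qProd q u = (1 - u) * qProd q (q * u) := by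
  have h : Multipliable fun n : ℕ => 1 - q ^ (n + 1) * u := by
    have := multipliable_one_add_of_summable (summable_norm_pow_mul hq (q * u))
    refine this.congr fun n => ?_
    rw [pow_succ]
    ring
  have h' : ∏' n : ℕ, (1 - q ^ (n + 1) * u) = qProd q (q * u) :=
    tprod_congr fun n => by rw [pow_succ, mul_assoc]
  rw [← h', qProd, tprod_eq_zero_mul' (f := fun n : ℕ => 1 - q ^ n * u) h, pow_zero, one_mul]

lemma qProd_ne_zero {u : ℂ} (hu : ∀ n : ℕ, q ^ n * u ≠ 1) : qProd q u ≠ 0 := by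
  simp only [qProd, sub_eq_add_neg]
  exact tprod_one_add_ne_zero_of_summable
    (fun n h => hu n (by linear_combination -h)) (summable_norm_pow_mul hq u)

lemma differentiable_qProd : Differentiable ℂ (qProd q) := by
  intro u
  have hu : u ∈ Metric.ball (0 : ℂ) (‖u‖ + 1) := by simp
  have hs : Summable fun n : ℕ => ‖q‖ ^ n * (‖u‖ + 1) :=
    (summable_geometric_of_lt_one (norm_nonneg q) hq).mul_right _
  have h := Summable.hasProdLocallyUniformlyOn_nat_one_add (f := fun n (u : ℂ) => -(q ^ n * u))
    (Metric.isOpen_ball (x := (0 : ℂ)) (ε := ‖u‖ + 1)) hs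
    (.of_forall fun n x hx => by
      rw [norm_neg, norm_mul, norm_pow]
      gcongr
      simpa using (mem_ball_zero_iff.1 hx).le)
    (fun n => by fun_prop)
  have hd := h.differentiableOn (.of_forall fun _ => by
    simpa [Finset.prod_fn] using DifferentiableOn.finsetProd (fun _ _ => by fun_prop))
    Metric.isOpen_ball
  simp only [← sub_eq_add_neg] at hd
  exact hd.differentiableAt (Metric.isOpen_ball.mem_nhds hu)

end QProd

lemma piC_ne_zero : piC ≠ 0 := by simp [piC, Real.pi_ne_zero]

lemma norm_qq_lt_one {τ : ℂ} (hτ : 0 < τ.im) : ‖qq τ‖ < 1 := by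
  rw [qq, norm_exp, Real.exp_lt_one_iff]
  have : (2 * piC * I * τ).re = -(2 * Real.pi * τ.im) := by simp [piC]
  rw [this]
  have := Real.pi_pos
  nlinarith [mul_pos this hτ]

/-- The pair of periods `π`, `πτ`. -/
def thetaPeriods (τ : ℂ) (hτ : 0 < τ.im) : PeriodPair where
  ω₁ := piC
  ω₂ := piC * τ
  indep := by
    rw [LinearIndependent.pair_iff]
    intro s t h
    simp only [real_smul] at h
    have h' : (s : ℂ) + t * τ = 0 := mul_left_cancel₀ piC_ne_zero (by linear_combination h)
    have ht : t = 0 := by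
      have := congrArg im h'
      simp only [add_im, ofReal_im, mul_im, ofReal_re, zero_mul, add_zero, zero_add, zero_im] at this
      exact (mul_eq_zero.1 this).resolve_right hτ.ne'
    subst ht
    exact ⟨by simpa using h', rfl⟩

lemma mem_thetaPeriods_lattice {τ : ℂ} (hτ : 0 < τ.im) {z : ℂ} :
    z ∈ (thetaPeriods τ hτ).lattice ↔ z ∈ Lambda τ := by
  simp only [PeriodPair.mem_lattice, Lambda, thetaPeriods, Set.mem_ofPred_eq, mul_assoc, eq_comm]

lemma wp_eq_weierstrassP {τ : ℂ} (hτ : 0 < τ.im) (z : ℂ) :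
    wp τ z = (thetaPeriods τ hτ).weierstrassP z := by
  rw [weierstrassP_eq, add_comm, wp, PeriodPair.weierstrassPExcept,
    ← (thetaPeriods τ hτ).latticeEquivProd.symm.toEquiv.tsum_eq]
  congr 1
  refine tsum_congr fun p => ?_
  have h : (((thetaPeriods τ hτ).latticeEquivProd.symm p : (thetaPeriods τ hτ).lattice) : ℂ) =
      (p.1 : ℂ) * piC + (p.2 : ℂ) * piC * τ := by
    rw [PeriodPair.latticeEquiv_symm_apply]
    simp only [thetaPeriods, mul_assoc]
  have h0 : (((thetaPeriods τ hτ).latticeEquivProd.symm p : (thetaPeriods τ hτ).lattice) : ℂ) = 0 ↔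
      p = (0, 0) := by
    rw [ZeroMemClass.coe_eq_zero, LinearEquiv.map_eq_zero_iff]
    rfl
  by_cases hp : p = (0, 0)
  · rw [if_pos hp, LinearEquiv.coe_toEquiv, if_pos (h0.2 hp)]
  · rw [if_neg hp, LinearEquiv.coe_toEquiv, if_neg (mt h0.1 hp), h]

lemma exp_two_pi_int (n : ℤ) : exp (n * (2 * piC * I)) = 1 := exp_int_mul_two_pi_mul_I n

/-- The product side of the Jacobi triple product, without its constant factor. -/
def thetaProd (τ z : ℂ) : ℂ :=
  exp (-(I * z)) * (qProd (qq τ) (exp (2 * I * z)) * qProd (qq τ) (qq τ * exp (-(2 * I * z))))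

section ThetaProd

variable {τ : ℂ} (hτ : 0 < τ.im)
include hτ

lemma thetaProd_eq_mul (z : ℂ) : thetaProd τ z = (exp (-(I * z)) - exp (I * z)) *
    (qProd (qq τ) (qq τ * exp (2 * I * z)) * qProd (qq τ) (qq τ * exp (-(2 * I * z)))) := by
  rw [thetaProd, qProd_eq_mul (norm_qq_lt_one hτ) (exp (2 * I * z)),
    show exp (I * z) = exp (-(I * z)) * exp (2 * I * z) by rw [← exp_add]; ring_nf]
  ring

lemma differentiable_thetaProd : Differentiable ℂ (thetaProd τ) := by
  have h := differentiable_qProd (norm_qq_lt_one hτ)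
  have h1 : Differentiable ℂ fun z => qProd (qq τ) (exp (2 * I * z)) :=
    h.comp (g := qProd (qq τ)) (f := fun z => exp (2 * I * z)) (by fun_prop)
  have h2 : Differentiable ℂ fun z => qProd (qq τ) (qq τ * exp (-(2 * I * z))) :=
    h.comp (g := qProd (qq τ)) (f := fun z => qq τ * exp (-(2 * I * z))) (by fun_prop)
  have h3 : Differentiable ℂ fun z => exp (-(I * z)) := by fun_prop
  exact h3.mul (h1.mul h2)

lemma thetaProd_neg (z : ℂ) : thetaProd τ (-z) = -thetaProd τ z := by
  rw [thetaProd_eq_mul hτ, thetaProd_eq_mul hτ]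
  simp only [mul_neg, neg_neg]
  ring

omit hτ in
lemma thetaProd_add_pi (z : ℂ) : thetaProd τ (z + piC) = -thetaProd τ z := by
  have h1 : exp (-(I * (z + piC))) = -exp (-(I * z)) := by
    rw [show -(I * (z + piC)) = -(I * z) - Real.pi * I by simp only [piC]; ring, exp_sub_pi_mul_I]
  have h2 : exp (2 * I * (z + piC)) = exp (2 * I * z) := by
    rw [show 2 * I * (z + piC) = 2 * I * z + 2 * Real.pi * I by simp only [piC]; ring, exp_add,
      exp_two_pi_mul_I, mul_one]
  simp only [thetaProd, exp_neg (2 * I * _), h1, h2]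
  ring

lemma thetaProd_add_pi_mul (z : ℂ) : thetaProd τ (z + piC * τ) =
    exp (-(2 * I) * z + (-(piC * I * τ) + piC * I)) * thetaProd τ z := by
  have hq := norm_qq_lt_one hτ
  have h1 : exp (2 * I * (z + piC * τ)) = qq τ * exp (2 * I * z) := by
    rw [qq, ← exp_add]; ring_nf
  have h2 : qq τ * exp (-(2 * I * (z + piC * τ))) = exp (-(2 * I * z)) := by
    rw [qq, ← exp_add]; ring_nf
  rw [thetaProd, thetaProd, h1, h2, qProd_eq_mul hq (exp (2 * I * z)),
    qProd_eq_mul hq (exp (-(2 * I * z)))]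
  have h3 : exp (-(2 * I) * z + (-(piC * I * τ) + piC * I)) =
      -(exp (-(2 * I * z)) * exp (-(piC * I * τ))) := by
    rw [exp_add, exp_add, piC, exp_pi_mul_I]; ring_nf
  have h4 : exp (-(I * (z + piC * τ))) = exp (-(I * z)) * exp (-(piC * I * τ)) := by
    rw [← exp_add]; ring_nf
  have h5 : exp (-(2 * I * z)) * exp (2 * I * z) = 1 := by
    rw [← exp_add, neg_add_cancel, exp_zero]
  rw [h3, h4]
  linear_combination (-(exp (-(I * z)) * exp (-(piC * I * τ)) *
    qProd (qq τ) (qq τ * exp (2 * I * z)) * qProd (qq τ) (qq τ * exp (-(2 * I * z))))) * h5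

omit hτ in
lemma mem_Lambda_of_exp {z : ℂ} {n : ℤ} (h : qq τ ^ n * exp (2 * I * z) = 1) : z ∈ Lambda τ := by
  rw [qq, ← exp_int_mul, ← exp_add, exp_eq_one_iff] at h
  obtain ⟨m, hm⟩ := h
  refine ⟨m, -n, ?_⟩
  have : 2 * I * z = 2 * I * ((m : ℂ) * piC + ((-n : ℤ) : ℂ) * piC * τ) := by
    push_cast
    simp only [piC] at *
    linear_combination hm
  exact mul_left_cancel₀ (by simp) this

lemma thetaProd_ne_zero {z : ℂ} (hz : z ∉ Lambda τ) : thetaProd τ z ≠ 0 := by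
  have hq := norm_qq_lt_one hτ
  refine mul_ne_zero (exp_ne_zero _) (mul_ne_zero (qProd_ne_zero hq fun n h => hz ?_)
    (qProd_ne_zero hq fun n h => hz ?_))
  · exact mem_Lambda_of_exp (n := n) (by exact_mod_cast h)
  · refine mem_Lambda_of_exp (n := -(n + 1 : ℕ)) ?_
    have h0 : qq τ ≠ 0 := exp_ne_zero _
    rw [exp_neg] at h
    have h1 := exp_ne_zero (2 * I * z)
    rw [zpow_neg, zpow_natCast]
    field_simp at h ⊢
    rw [← h]
    ring

lemma deriv_thetaProd_zero_ne : deriv (thetaProd τ) 0 ≠ 0 := by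
  have hq := norm_qq_lt_one hτ
  let R : ℂ → ℂ := fun z =>
    qProd (qq τ) (qq τ * exp (2 * I * z)) * qProd (qq τ) (qq τ * exp (-(2 * I * z)))
  have hR : Differentiable ℂ R := by
    have h := differentiable_qProd hq
    exact (h.comp (g := qProd (qq τ)) (f := fun z => qq τ * exp (2 * I * z)) (by fun_prop)).mul
      (h.comp (g := qProd (qq τ)) (f := fun z => qq τ * exp (-(2 * I * z))) (by fun_prop))
  have hR0 : R 0 ≠ 0 := by
    have : qProd (qq τ) (qq τ) ≠ 0 := qProd_ne_zero hq fun n h => by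
      have h1 : ‖qq τ ^ (n + 1)‖ < 1 := by
        rw [norm_pow]
        exact pow_lt_one₀ (norm_nonneg _) hq (by simp)
      rw [pow_succ, h, norm_one] at h1
      exact lt_irrefl _ h1
    simpa [R] using this
  have hs : HasDerivAt (fun z : ℂ => exp (-(I * z)) - exp (I * z)) (-(2 * I)) 0 := by
    have h1 : HasDerivAt (fun z : ℂ => I * z) I 0 := by
      simpa using (hasDerivAt_id (0 : ℂ)).const_mul I
    have h2 := h1.fun_neg.cexp.sub h1.cexp
    simp only [mul_zero, neg_zero, exp_zero, one_mul] at h2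
    exact h2.congr_deriv (by ring)
  have h := hs.mul (hR 0).hasDerivAt
  have he : thetaProd τ = (fun z : ℂ => exp (-(I * z)) - exp (I * z)) * R :=
    funext (thetaProd_eq_mul hτ)
  rw [he, h.deriv]
  simpa using hR0

theorem isSigmaLike_thetaProd : IsSigmaLike (thetaPeriods τ hτ) (thetaProd τ) where
  differentiable := differentiable_thetaProd hτ
  odd := thetaProd_neg hτ
  deriv_zero_ne := deriv_thetaProd_zero_ne hτ
  ne_zero z hz := thetaProd_ne_zero hτ (mt (mem_thetaPeriods_lattice hτ).2 hz)
  quasi₁ := ⟨0, piC * I, fun z => by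
    rw [zero_mul, zero_add, piC, exp_pi_mul_I, neg_one_mul]
    exact thetaProd_add_pi z⟩
  quasi₂ := ⟨_, _, thetaProd_add_pi_mul hτ⟩

end ThetaProd

/-- The translate of Mathlib's Jacobi theta function that is proportional to `theta1`. -/
def thetaShift (τ z : ℂ) : ℂ := exp (I * z) * jacobiTheta₂ (z / piC + (1 + τ) / 2) τ

lemma theta1_eq (z τ : ℂ) : theta1 z τ = -I * exp (piC * I * τ / 4) * thetaShift τ z := by
  rw [theta1, thetaShift, jacobiTheta₂, ← tsum_mul_left (a := exp (I * z))]
  congr 1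
  refine tsum_congr fun n => ?_
  have hn : (-1 : ℂ) ^ n = exp (n * (piC * I)) := by
    rw [exp_int_mul, piC, exp_pi_mul_I]
  rw [jacobiTheta₂_term, hn, ← exp_add, ← exp_add, ← exp_add]
  congr 1
  have hpi : (Real.pi : ℂ) * (z / Real.pi) = z :=
    mul_div_cancel₀ z (ofReal_ne_zero.2 Real.pi_ne_zero)
  simp only [piC]
  linear_combination -2 * I * n * hpi

section ThetaShift

variable {τ : ℂ} (hτ : 0 < τ.im)
include hτ

lemma differentiable_thetaShift : Differentiable ℂ (thetaShift τ) := by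
  have h : Differentiable ℂ fun z : ℂ => jacobiTheta₂ z τ :=
    fun z => differentiableAt_jacobiTheta₂_fst z hτ
  have h1 : Differentiable ℂ fun z => jacobiTheta₂ (z / piC + (1 + τ) / 2) τ :=
    Differentiable.comp (g := fun z : ℂ => jacobiTheta₂ z τ)
      (f := fun z : ℂ => z / piC + (1 + τ) / 2) h (by fun_prop)
  have h2 : Differentiable ℂ fun z => exp (I * z) := by fun_prop
  exact h2.mul h1

omit hτ in
lemma thetaShift_add_pi (z : ℂ) : thetaShift τ (z + piC) = -thetaShift τ z := by
  have h1 : exp (I * (z + piC)) = -exp (I * z) := by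
    rw [mul_add, exp_add, mul_comm I piC, piC, exp_pi_mul_I]; ring
  have h2 : (z + piC) / piC + (1 + τ) / 2 = (z / piC + (1 + τ) / 2) + 1 := by
    rw [add_div, div_self piC_ne_zero]; ring
  rw [thetaShift, thetaShift, h1, h2, jacobiTheta₂_add_left]
  ring

omit hτ in
lemma thetaShift_add_pi_mul (z : ℂ) : thetaShift τ (z + piC * τ) =
    exp (-(2 * I) * z + (-(piC * I * τ) + piC * I)) * thetaShift τ z := by
  have h2 : (z + piC * τ) / piC + (1 + τ) / 2 = (z / piC + (1 + τ) / 2) + τ := by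
    rw [add_div, mul_div_cancel_left₀ _ piC_ne_zero]; ring
  have hpi : (Real.pi : ℂ) * (z / Real.pi) = z :=
    mul_div_cancel₀ z (ofReal_ne_zero.2 Real.pi_ne_zero)
  rw [thetaShift, thetaShift, h2, jacobiTheta₂_add_left', ← mul_assoc, ← mul_assoc, ← exp_add,
    ← exp_add]
  congr 1
  rw [exp_eq_exp_iff_exists_int]
  refine ⟨-1, ?_⟩
  simp only [piC]
  push_cast
  linear_combination -2 * I * hpi

omit hτ in
lemma thetaShift_zero : thetaShift τ 0 = 0 := by
  have h1 : jacobiTheta₂ ((1 + τ) / 2) τ = -jacobiTheta₂ ((1 + τ) / 2) τ := by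
    have h2 := jacobiTheta₂_add_left' ((1 - τ) / 2) τ
    have h3 := jacobiTheta₂_add_left (-((1 + τ) / 2)) τ
    rw [jacobiTheta₂_neg_left, show -((1 + τ) / 2) + 1 = (1 - τ) / 2 by ring] at h3
    rw [h3, show (1 - τ) / 2 + τ = (1 + τ) / 2 by ring,
      show -(Real.pi : ℂ) * I * (τ + 2 * ((1 - τ) / 2)) = -(Real.pi * I) by ring, exp_neg,
      exp_pi_mul_I] at h2
    linear_combination h2
  rw [thetaShift, zero_div, zero_add, CharZero.eq_neg_self_iff.1 h1, mul_zero]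

lemma integral_jacobiTheta₂ : ∫ x : ℝ in (0 : ℝ)..1, jacobiTheta₂ x τ = 1 := by
  let f : ℤ → C(ℝ, ℂ) := fun n => ⟨fun x => jacobiTheta₂_term n x τ, by
    unfold jacobiTheta₂_term; fun_prop⟩
  have hnorm : ∀ (n : ℤ) (x : ℝ), ‖f n x‖ = ‖jacobiTheta₂_term n 0 τ‖ := fun n x => by
    change ‖jacobiTheta₂_term n x τ‖ = _
    simp [norm_jacobiTheta₂_term]
  have hsum : Summable fun n : ℤ => ‖(f n).restrict
      (⟨Set.uIcc (0 : ℝ) 1, isCompact_uIcc⟩ : TopologicalSpace.Compacts ℝ)‖ := by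
    refine Summable.of_nonneg_of_le (fun n => norm_nonneg _) (fun n => ?_)
      ((summable_jacobiTheta₂_term_iff 0 τ).2 hτ).norm
    refine (ContinuousMap.norm_le _ (norm_nonneg _)).2 fun x => ?_
    exact (hnorm n x).le
  have h := intervalIntegral.hasSum_intervalIntegral_of_summable_norm hsum
  have h0 : ∀ n : ℤ, n ≠ 0 → ∫ x : ℝ in (0 : ℝ)..1, f n x = 0 := by
    intro n hn
    have hc : (2 * Real.pi * I * n : ℂ) ≠ 0 := by
      simp [Real.pi_ne_zero, hn]
    have he : ∀ x : ℝ, f n x = exp (Real.pi * I * n ^ 2 * τ) * exp (2 * Real.pi * I * n * x) := by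
      intro x
      change jacobiTheta₂_term n x τ = _
      rw [jacobiTheta₂_term, exp_add, mul_comm]
    simp only [he]
    rw [intervalIntegral.integral_const_mul, integral_exp_mul_complex hc]
    have : exp (2 * Real.pi * I * n * (1 : ℝ)) = 1 := by
      rw [← exp_two_pi_int n, piC]
      congr 1
      push_cast
      ring
    rw [this]
    simp
  have h1 : ∫ x : ℝ in (0 : ℝ)..1, f 0 x = 1 := by
    have he : ∀ x : ℝ, f 0 x = 1 := fun x => by
      change jacobiTheta₂_term 0 x τ = 1
      simp [jacobiTheta₂_term]
    simp [he]
  rw [← h1]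
  exact h.unique (hasSum_single 0 h0)

lemma exists_thetaShift_ne_zero : ∃ z, thetaShift τ z ≠ 0 := by
  by_contra! h
  have h1 : ∀ z, jacobiTheta₂ z τ = 0 := fun z => by
    have := h (piC * (z - (1 + τ) / 2))
    rw [thetaShift, mul_div_cancel_left₀ _ piC_ne_zero, sub_add_cancel] at this
    exact (mul_eq_zero.1 this).resolve_left (exp_ne_zero _)
  have h2 := integral_jacobiTheta₂ hτ
  simp [h1] at h2

/-- The Jacobi triple product, up to the value of the constant. -/
theorem exists_thetaShift_eq_mul_thetaProd :
    ∃ c : ℂ, c ≠ 0 ∧ ∀ z ∉ Lambda τ, thetaShift τ z = c * thetaProd τ z := by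
  have hP := isSigmaLike_thetaProd hτ
  set L := thetaPeriods τ hτ with hL
  have hT := differentiable_thetaShift hτ
  let f : ℂ → ℂ := fun z => thetaShift τ z / thetaProd τ z
  have h₁ : GenericallyPeriodic f L.ω₁ := fun x => .of_forall fun z => by
    change thetaShift τ (z + piC) / thetaProd τ (z + piC) = _
    rw [thetaShift_add_pi, thetaProd_add_pi, neg_div_neg_eq]
  have h₂ : GenericallyPeriodic f L.ω₂ := fun x => .of_forall fun z => by
    change thetaShift τ (z + piC * τ) / thetaProd τ (z + piC * τ) = _
    rw [thetaShift_add_pi_mul, thetaProd_add_pi_mul hτ, mul_div_mul_left _ _ (exp_ne_zero _)]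
  have han : ∀ z ∉ L.lattice, AnalyticAt ℂ f z := fun z hz =>
    (hT.analyticAt z).div (hP.differentiable.analyticAt z) (hP.ne_zero z hz)
  have hP0 : thetaProd τ 0 = 0 := by
    have := hP.odd 0
    rw [neg_zero] at this
    exact CharZero.eq_neg_self_iff.1 this
  have hdslope : ∀ {E : ℂ → ℂ}, Differentiable ℂ E → AnalyticAt ℂ (dslope E 0) 0 := by
    intro E hE
    obtain ⟨p, hp⟩ := hE.analyticAt 0
    exact ⟨_, hp.has_fpower_series_dslope_fslope⟩
  have h0 : RemovableAt f 0 := by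
    refine ⟨fun z => dslope (thetaShift τ) 0 z / dslope (thetaProd τ) 0 z,
      (hdslope hT).div (hdslope hP.differentiable) ?_, ?_⟩
    · rw [dslope_same]
      exact hP.deriv_zero_ne
    · filter_upwards [self_mem_nhdsWithin] with z hz
      have hz' : z ≠ 0 := hz
      have h1 := sub_smul_dslope (thetaShift τ) 0 z
      have h2 := sub_smul_dslope (thetaProd τ) 0 z
      simp only [sub_zero, thetaShift_zero, hP0, smul_eq_mul] at h1 h2
      simp only [f]
      rw [← h1, ← h2, mul_div_mul_left _ _ hz']
  obtain ⟨c, hc⟩ := exists_const_of_removableAt L (f := f) h₁ h₂ (fun z => by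
      by_cases hz : z ∈ L.lattice
      · exact ⟨-z, neg_mem hz, by rwa [add_neg_cancel]⟩
      · exact ⟨0, zero_mem _, by rw [add_zero]; exact removableAt_of_analyticAt (han z hz)⟩)
  have hmul : ∀ z ∉ L.lattice, thetaShift τ z = c * thetaProd τ z := fun z hz => by
    rw [← hc z f (han z hz) EventuallyEq.rfl, div_mul_cancel₀ _ (hP.ne_zero z hz)]
  refine ⟨c, ?_, fun z hz => hmul z (mt (mem_thetaPeriods_lattice hτ).1 hz)⟩
  rintro rfl
  obtain ⟨z, hz⟩ := exists_thetaShift_ne_zero hτ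
  have hev : ∀ᶠ w in 𝓝[≠] z, thetaShift τ w = 0 := by
    filter_upwards [eventually_notMem_lattice L z] with w hw
    rw [hmul w hw, zero_mul]
  have hne := (hT.continuous.continuousAt.eventually_ne hz).filter_mono
    (nhdsWithin_le_nhds (s := {z}ᶜ))
  obtain ⟨w, hw, hw'⟩ := (hev.and hne).exists
  exact hw' hw

lemma logDeriv_theta1 {z : ℂ} (hz : z ∉ Lambda τ) :
    deriv (fun w => theta1 w τ) z / theta1 z τ = logDeriv (thetaProd τ) z := by
  obtain ⟨c, hc, h⟩ := exists_thetaShift_eq_mul_thetaProd hτ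
  set C := -I * exp (piC * I * τ / 4) * c with hC
  have hC0 : C ≠ 0 := mul_ne_zero (mul_ne_zero (by simp) (exp_ne_zero _)) hc
  have heq : ∀ w ∉ Lambda τ, theta1 w τ = C * thetaProd τ w := fun w hw => by
    rw [theta1_eq, h w hw, hC]; ring
  have hz' : z ∉ (thetaPeriods τ hτ).lattice := mt (mem_thetaPeriods_lattice hτ).1 hz
  have hev : (fun w => theta1 w τ) =ᶠ[𝓝 z] fun w => C * thetaProd τ w := by
    filter_upwards [(thetaPeriods τ hτ).isClosed_lattice.isOpen_compl.mem_nhds hz'] with w hw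
    exact heq w (mt (mem_thetaPeriods_lattice hτ).2 hw)
  rw [hev.deriv_eq, heq z hz, deriv_const_mul_field, mul_div_mul_left _ _ hC0, logDeriv_apply]

end ThetaShift

theorem statement15 (τ : ℂ) (hτ : 0 < τ.im) (x y : ℂ)
    (hx : x ∉ Lambda τ) (hy : y ∉ Lambda τ) (hxy : x + y ∉ Lambda τ) :
    (deriv (fun w => theta1 w τ) x / theta1 x τ
      + deriv (fun w => theta1 w τ) y / theta1 y τ
      - deriv (fun w => theta1 w τ) (x + y) / theta1 (x + y) τ) ^ 2
    = wp τ x + wp τ y + wp τ (x + y) := by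
  rw [logDeriv_theta1 hτ hx, logDeriv_theta1 hτ hy, logDeriv_theta1 hτ hxy,
    wp_eq_weierstrassP hτ, wp_eq_weierstrassP hτ, wp_eq_weierstrassP hτ]
  exact (isSigmaLike_thetaProd hτ).logDeriv_add_logDeriv_sub_sq
    (mt (mem_thetaPeriods_lattice hτ).1 hx) (mt (mem_thetaPeriods_lattice hτ).1 hy)
    (mt (mem_thetaPeriods_lattice hτ).1 hxy)
end Liu
end
end

section
/- One has θ₁(2π/5|τ)/θ₁(π/5|τ) − θ₁(π/5|τ)/θ₁(2π/5|τ) = 1 + 5·η(25τ)/η(τ). -/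
noncomputable section

open Complex

namespace Liu

open Filter Topology

/-- The partial product `∏_{i < n} (1 - q ^ (i + 1))`. -/
def qFactorial (q : ℂ) (n : ℕ) : ℂ := ∏ i ∈ Finset.range n, (1 - q ^ (i + 1))

/-- The reciprocal of `qFactorial`, extended by zero to negative integers. -/
def qFactorialInv (q : ℂ) (k : ℤ) : ℂ := if k < 0 then 0 else (qFactorial q k.toNat)⁻¹

lemma one_sub_pow_succ_ne_zero {q : ℂ} (hq : ‖q‖ < 1) (n : ℕ) : 1 - q ^ (n + 1) ≠ 0 := by
  intro h
  have h1 : ‖q ^ (n + 1)‖ = 1 := by rw [← sub_eq_zero.mp h]; simp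
  rw [norm_pow] at h1
  exact (pow_lt_one₀ (norm_nonneg q) hq n.succ_ne_zero).ne h1

lemma summable_norm_mul_pow {q : ℂ} (hq : ‖q‖ < 1) (x : ℂ) :
    Summable fun n : ℕ => ‖-(x * q ^ n)‖ := by
  simpa using (summable_geometric_of_lt_one (norm_nonneg q) hq).mul_left ‖x‖

lemma multipliable_one_sub_mul_pow {q : ℂ} (hq : ‖q‖ < 1) (x : ℂ) :
    Multipliable fun n : ℕ => 1 - x * q ^ n := by
  simpa [sub_eq_add_neg] using multipliable_one_add_of_summable (summable_norm_mul_pow hq x)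

lemma tprod_one_sub_pow_ne_zero {q : ℂ} (hq : ‖q‖ < 1) : ∏' n : ℕ, (1 - q ^ (n + 1)) ≠ 0 := by
  have h := tprod_one_add_ne_zero_of_summable (f := fun n : ℕ => -(q * q ^ n))
    (fun n => by simpa [sub_eq_add_neg, pow_succ'] using one_sub_pow_succ_ne_zero hq n)
    (summable_norm_mul_pow hq q)
  simpa [sub_eq_add_neg, pow_succ'] using h

lemma tendsto_qFactorial {q : ℂ} (hq : ‖q‖ < 1) :
    Tendsto (qFactorial q) atTop (𝓝 (∏' n : ℕ, (1 - q ^ (n + 1)))) := by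
  have h := (multipliable_one_sub_mul_pow hq q).hasProd.tendsto_prod_nat
  simp_rw [← pow_succ'] at h
  exact h

lemma qFactorial_ne_zero {q : ℂ} (hq : ‖q‖ < 1) (n : ℕ) : qFactorial q n ≠ 0 :=
  Finset.prod_ne_zero_iff.mpr fun i _ => one_sub_pow_succ_ne_zero hq i

lemma qFactorialInv_sub_one {q : ℂ} (hq : ‖q‖ < 1) (k : ℤ) :
    qFactorialInv q (k - 1) = (1 - q ^ k) * qFactorialInv q k := by
  rcases lt_trichotomy k 0 with hk | rfl | hk
  · simp [qFactorialInv, hk, show k < 1 by omega]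
  · simp [qFactorialInv]
  · obtain ⟨n, rfl⟩ : ∃ n : ℕ, k = n + 1 := ⟨(k - 1).toNat, by omega⟩
    have h1 : ((n : ℤ) + 1).toNat = n + 1 := by omega
    have h2 : ¬ ((n : ℤ) + 1 < 0) := by omega
    have h3 := one_sub_pow_succ_ne_zero hq n
    have h4 := qFactorial_ne_zero hq n
    have h5 : q ^ ((n : ℤ) + 1) = q ^ (n + 1) := by exact_mod_cast zpow_natCast q (n + 1)
    simp only [qFactorialInv, add_sub_cancel_right, h2, h1, h5, if_false, Int.toNat_natCast,
      show ¬ ((n : ℤ) < 0) by omega]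
    rw [qFactorial, qFactorial, Finset.prod_range_succ]
    rw [qFactorial] at h4
    field_simp

lemma tendsto_qFactorialInv {q : ℂ} (hq : ‖q‖ < 1) :
    Tendsto (qFactorialInv q) atTop (𝓝 (∏' n : ℕ, (1 - q ^ (n + 1)))⁻¹) := by
  have h := ((tendsto_qFactorial hq).inv₀ (tprod_one_sub_pow_ne_zero hq)).comp
    (tendsto_atTop_atTop.mpr fun b : ℕ => ⟨(b : ℤ), fun a ha => by omega⟩ :
      Tendsto Int.toNat atTop atTop)
  refine h.congr' ?_
  filter_upwards [eventually_ge_atTop 0] with k hk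
  simp [qFactorialInv, not_lt.mpr hk]

lemma exists_norm_qFactorial_le {q : ℂ} (hq : ‖q‖ < 1) :
    ∃ C, 0 ≤ C ∧ ∀ n, ‖qFactorial q n‖ ≤ C := by
  obtain ⟨C, hC⟩ := (Metric.isBounded_range_of_tendsto _ (tendsto_qFactorial hq)).exists_norm_le
  exact ⟨C, (norm_nonneg _).trans (hC _ ⟨0, rfl⟩), fun n => hC _ ⟨n, rfl⟩⟩

lemma exists_norm_qFactorialInv_le {q : ℂ} (hq : ‖q‖ < 1) :
    ∃ C, 0 ≤ C ∧ ∀ k, ‖qFactorialInv q k‖ ≤ C := by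
  obtain ⟨C, hC⟩ := (Metric.isBounded_range_of_tendsto _
    ((tendsto_qFactorial hq).inv₀ (tprod_one_sub_pow_ne_zero hq))).exists_norm_le
  have h0 : 0 ≤ C := (norm_nonneg _).trans (hC _ ⟨0, rfl⟩)
  refine ⟨C, h0, fun k => ?_⟩
  rw [qFactorialInv]
  split_ifs
  · simpa using h0
  · exact hC _ ⟨k.toNat, rfl⟩

/-- The centred Gaussian binomial coefficient `[2m, m + n]_q`. -/
def centeredGaussBinom (q : ℂ) (m : ℕ) (n : ℤ) : ℂ :=
  qFactorial q (2 * m) * qFactorialInv q (m + n) * qFactorialInv q (m - n)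

lemma centeredGaussBinom_succ {q : ℂ} (hq0 : q ≠ 0) (hq : ‖q‖ < 1) (m : ℕ) (n : ℤ) :
    centeredGaussBinom q (m + 1) n =
      (1 + q ^ (2 * m + 1)) * centeredGaussBinom q m n
        + q ^ (m - n + 1 : ℤ) * centeredGaussBinom q m (n - 1)
        + q ^ (m + n + 1 : ℤ) * centeredGaussBinom q m (n + 1) := by
  have e1 := qFactorialInv_sub_one hq (m + n + 1)
  have e2 := qFactorialInv_sub_one hq (m + n)
  have e3 := qFactorialInv_sub_one hq (m - n + 1)
  have e4 := qFactorialInv_sub_one hq (m - n)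
  rw [add_sub_cancel_right] at e1 e3
  have hA : q ^ (m + n + 1 : ℤ) = q ^ (m + n : ℤ) * q := zpow_add_one₀ hq0 _
  have hB : q ^ (m - n + 1 : ℤ) = q ^ (m - n : ℤ) * q := zpow_add_one₀ hq0 _
  have hAB : q ^ (2 * m) = q ^ (m + n : ℤ) * q ^ (m - n : ℤ) := by
    rw [← zpow_add₀ hq0, ← zpow_natCast]
    congr 1
    push_cast
    ring
  have hP : qFactorial q (2 * (m + 1)) =
      qFactorial q (2 * m) * (1 - q ^ (2 * m) * q) * (1 - q ^ (2 * m) * q ^ 2) := by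
    rw [show 2 * (m + 1) = 2 * m + 1 + 1 by ring, qFactorial, Finset.prod_range_succ,
      Finset.prod_range_succ, ← qFactorial]
    ring
  have i1 : (m + (n - 1) : ℤ) = m + n - 1 := by ring
  have i2 : (m - (n - 1) : ℤ) = m - n + 1 := by ring
  have i3 : (m + (n + 1) : ℤ) = m + n + 1 := by ring
  have i4 : (m - (n + 1) : ℤ) = m - n - 1 := by ring
  have i5 : ((m + 1 : ℕ) + n : ℤ) = m + n + 1 := by push_cast; ring
  have i6 : ((m + 1 : ℕ) - n : ℤ) = m - n + 1 := by push_cast; ring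
  simp only [centeredGaussBinom, i1, i2, i3, i4, i5, i6]
  rw [e2, e4, e1, e3, hP, pow_succ q (2 * m), hAB, hA, hB]
  ring

lemma hasSum_finite_jacobi_triple_product {w x : ℂ} (hw0 : w ≠ 0) (hw : ‖w‖ < 1) (hx : x ≠ 0)
    (m : ℕ) :
    HasSum (fun n : ℤ => (-1) ^ n * w ^ (n * (n - 1)) * x ^ n * centeredGaussBinom (w ^ 2) m n)
      (∏ i ∈ Finset.range m, ((1 - x * (w ^ 2) ^ i) * (1 - w ^ 2 / x * (w ^ 2) ^ i))) := by
  have hq0 : w ^ 2 ≠ 0 := pow_ne_zero 2 hw0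
  have hq : ‖w ^ 2‖ < 1 := by rw [norm_pow]; exact pow_lt_one₀ (norm_nonneg w) hw two_ne_zero
  induction m with
  | zero =>
    convert hasSum_single (0 : ℤ) ?_ using 1
    · simp [centeredGaussBinom, qFactorialInv, qFactorial]
    · intro n hn
      rcases lt_or_gt_of_ne hn with h | h
      · simp [centeredGaussBinom, qFactorialInv, h]
      · simp [centeredGaussBinom, qFactorialInv, h]
  | succ m ih =>
    rw [Finset.prod_range_succ]
    have h1 := (Equiv.subRight (1 : ℤ)).hasSum_iff.mpr ih
    have h2 := (Equiv.addRight (1 : ℤ)).hasSum_iff.mpr ih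
    have h := ((ih.mul_left (1 + (w ^ 2) ^ (2 * m + 1))).add
      (h1.mul_left (-(x * (w ^ 2) ^ m)))).add (h2.mul_left (-((w ^ 2) ^ (m + 1) / x)))
    refine (congrArg₂ HasSum (funext fun n => ?_) ?_).mpr h
    · rw [centeredGaussBinom_succ hq0 hq]
      simp only [Function.comp, Equiv.subRight_apply, Equiv.coe_addRight]
      have e1 : (-1 : ℂ) ^ (n - 1) = -(-1) ^ n := by
        rw [zpow_sub_one₀ (by norm_num)]; norm_num
      have e2 : (-1 : ℂ) ^ (n + 1) = -(-1) ^ n := by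
        rw [zpow_add_one₀ (by norm_num)]; norm_num
      have e3 : x ^ (n - 1) * x = x ^ n := by rw [zpow_sub_one₀ hx]; field_simp
      have e4 : x ^ (n + 1) / x = x ^ n := by rw [zpow_add_one₀ hx]; field_simp
      have e5 : w ^ (n * (n - 1)) * (w ^ 2) ^ (m - n + 1 : ℤ)
          = w ^ ((n - 1) * (n - 1 - 1)) * (w ^ 2) ^ m := by
        rw [← zpow_natCast w 2, ← zpow_natCast _ m, ← zpow_mul, ← zpow_mul, ← zpow_add₀ hw0,
          ← zpow_add₀ hw0]
        congr 1; push_cast; ring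
      have e6 : w ^ (n * (n - 1)) * (w ^ 2) ^ (m + n + 1 : ℤ)
          = w ^ ((n + 1) * (n + 1 - 1)) * (w ^ 2) ^ (m + 1) := by
        rw [← zpow_natCast w 2, ← zpow_natCast _ (m + 1), ← zpow_mul, ← zpow_mul,
          ← zpow_add₀ hw0, ← zpow_add₀ hw0]
        congr 1; push_cast; ring
      rw [e1, e2]
      linear_combination
        (-1 : ℂ) ^ n * x ^ n * centeredGaussBinom (w ^ 2) m (n - 1) * e5
        + (-1 : ℂ) ^ n * x ^ n * centeredGaussBinom (w ^ 2) m (n + 1) * e6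
        - (-1 : ℂ) ^ n * w ^ ((n - 1) * (n - 1 - 1)) * (w ^ 2) ^ m
          * centeredGaussBinom (w ^ 2) m (n - 1) * e3
        - (-1 : ℂ) ^ n * w ^ ((n + 1) * (n + 1 - 1)) * (w ^ 2) ^ (m + 1)
          * centeredGaussBinom (w ^ 2) m (n + 1) * e4
    · field_simp
      ring

lemma summable_zpow_mul_zpow {w x : ℂ} (hw0 : w ≠ 0) (hw : ‖w‖ < 1) (hx : x ≠ 0) :
    Summable fun n : ℤ => w ^ (n * (n - 1)) * x ^ n := by
  have hpi : (Real.pi : ℂ) ≠ 0 := by exact_mod_cast Real.pi_ne_zero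
  set τ : ℂ := Complex.log w / (Real.pi * I) with hτ
  set z : ℂ := Complex.log (x / w) / (2 * Real.pi * I) with hz
  have hwτ : w = cexp (Real.pi * I * τ) := by
    rw [hτ, mul_div_cancel₀ _ (mul_ne_zero hpi I_ne_zero), exp_log hw0]
  have hxz : x / w = cexp (2 * Real.pi * I * z) := by
    rw [hz, mul_div_cancel₀ _ (by simp [hpi]), exp_log (div_ne_zero hx hw0)]
  have him : 0 < τ.im := by
    have h : Real.exp (-(Real.pi * τ.im)) < 1 := by
      have := hw
      rw [hwτ, Complex.norm_exp] at this
      simpa using this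
    rw [Real.exp_lt_one_iff] at h
    nlinarith [Real.pi_pos]
  refine ((summable_jacobiTheta₂_term_iff z τ).mpr him).congr fun n => ?_
  have : w ^ (n * (n - 1)) * x ^ n = w ^ (n ^ 2) * (x / w) ^ n := by
    rw [div_zpow, show n * (n - 1) = n ^ 2 - n by ring, zpow_sub₀ hw0]
    ring
  rw [this, hwτ, ← hwτ, hxz, hwτ, ← Complex.exp_int_mul, ← Complex.exp_int_mul, ← Complex.exp_add,
    jacobiTheta₂_term]
  congr 1
  push_cast
  ring

/-- The Jacobi triple product identity. -/
theorem jacobi_triple_product {w x : ℂ} (hw0 : w ≠ 0) (hw : ‖w‖ < 1) (hx : x ≠ 0) :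
    ∑' n : ℤ, (-1) ^ n * w ^ (n * (n - 1)) * x ^ n =
      (∏' i : ℕ, (1 - (w ^ 2) ^ (i + 1))) * (∏' i : ℕ, (1 - x * (w ^ 2) ^ i))
        * ∏' i : ℕ, (1 - w ^ 2 / x * (w ^ 2) ^ i) := by
  have hq : ‖w ^ 2‖ < 1 := by rw [norm_pow]; exact pow_lt_one₀ (norm_nonneg w) hw two_ne_zero
  have hL : Tendsto (fun m => ∏ i ∈ Finset.range m,
      ((1 - x * (w ^ 2) ^ i) * (1 - w ^ 2 / x * (w ^ 2) ^ i))) atTop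
      (𝓝 ((∏' i : ℕ, (1 - x * (w ^ 2) ^ i)) * ∏' i : ℕ, (1 - w ^ 2 / x * (w ^ 2) ^ i))) := by
    simp_rw [Finset.prod_mul_distrib]
    exact (multipliable_one_sub_mul_pow hq _).hasProd.tendsto_prod_nat.mul
      (multipliable_one_sub_mul_pow hq _).hasProd.tendsto_prod_nat
  obtain ⟨C, hC0, hC⟩ := exists_norm_qFactorial_le hq
  obtain ⟨D, hD0, hD⟩ := exists_norm_qFactorialInv_le hq
  have hP := tprod_one_sub_pow_ne_zero hq
  have hR : Tendsto (fun m : ℕ => ∑' n : ℤ,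
      (-1) ^ n * w ^ (n * (n - 1)) * x ^ n * centeredGaussBinom (w ^ 2) m n) atTop
      (𝓝 (∑' n : ℤ, (-1) ^ n * w ^ (n * (n - 1)) * x ^ n
        * (∏' i : ℕ, (1 - (w ^ 2) ^ (i + 1)))⁻¹)) := by
    refine tendsto_tsum_of_dominated_convergence
      (bound := fun n => ‖w ^ (n * (n - 1)) * x ^ n‖ * (C * D * D))
      ((summable_zpow_mul_zpow hw0 hw hx).norm.mul_right _) (fun n => ?_)
      (Eventually.of_forall fun m n => ?_)
    · refine Tendsto.const_mul _ ?_
      have t0 : Tendsto (fun m : ℕ => 2 * m) atTop atTop :=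
        tendsto_id.const_mul_atTop' two_pos
      have t1 : Tendsto (fun m : ℕ => (m + n : ℤ)) atTop atTop :=
        tendsto_atTop_add_const_right _ _ tendsto_natCast_atTop_atTop
      have t2 : Tendsto (fun m : ℕ => (m - n : ℤ)) atTop atTop :=
        tendsto_atTop_add_const_right _ _ tendsto_natCast_atTop_atTop
      have h := (((tendsto_qFactorial hq).comp t0).mul ((tendsto_qFactorialInv hq).comp t1)).mul
        ((tendsto_qFactorialInv hq).comp t2)
      rwa [mul_inv_cancel₀ hP, one_mul] at h
    · rw [mul_assoc ((-1 : ℂ) ^ n), norm_mul, norm_mul ((-1 : ℂ) ^ n), norm_zpow, norm_neg, norm_one,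
        one_zpow, one_mul, centeredGaussBinom, norm_mul (_ * _) (qFactorialInv _ _),
        norm_mul (qFactorial _ _)]
      gcongr
      exacts [hC _, hD _, hD _]
  rw [tsum_mul_right] at hR
  have h := tendsto_nhds_unique hR
    (hL.congr fun m => (hasSum_finite_jacobi_triple_product hw0 hw hx m).tsum_eq.symm)
  rw [mul_assoc, ← h]
  field_simp

lemma tprod_one_sub_mul_pow_eq {q : ℂ} (hq : ‖q‖ < 1) (x : ℂ) :
    ∏' i : ℕ, (1 - x * q ^ i) = (1 - x) * ∏' i : ℕ, (1 - x * q * q ^ i) := by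
  have h (i : ℕ) : 1 - x * q ^ (i + 1) = 1 - x * q * q ^ i := by ring
  rw [tprod_eq_zero_mul' (by simpa only [h] using multipliable_one_sub_mul_pow hq (x * q))]
  simp only [h, pow_zero, mul_one]

lemma tprod_one_sub_pow_residues {q : ℂ} (hq : ‖q‖ < 1) :
    ∏' i : ℕ, (1 - q ^ (i + 1)) =
      (∏' i : ℕ, (1 - q * (q ^ 5) ^ i)) * (∏' i : ℕ, (1 - q ^ 2 * (q ^ 5) ^ i))
        * (∏' i : ℕ, (1 - q ^ 3 * (q ^ 5) ^ i)) * (∏' i : ℕ, (1 - q ^ 4 * (q ^ 5) ^ i))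
        * ∏' i : ℕ, (1 - (q ^ 5) ^ (i + 1)) := by
  have hq5 : ‖q ^ 5‖ < 1 := by rw [norm_pow]; exact pow_lt_one₀ (norm_nonneg q) hq (by norm_num)
  have t (x : ℂ) := (multipliable_one_sub_mul_pow hq5 x).hasProd.tendsto_prod_nat
  have h := ((((t q).mul (t (q ^ 2))).mul (t (q ^ 3))).mul (t (q ^ 4))).mul (tendsto_qFactorial hq5)
  refine tendsto_nhds_unique ((tendsto_qFactorial hq).comp
    (tendsto_id.const_mul_atTop' (show 0 < 5 by norm_num))) (h.congr fun n => ?_)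
  simp only [Function.comp, id]
  induction n with
  | zero => simp [qFactorial]
  | succ n ih =>
    rw [qFactorial] at ih
    rw [show 5 * (n + 1) = 5 * n + 1 + 1 + 1 + 1 + 1 by ring]
    simp only [qFactorial, Finset.prod_range_succ] at ih ⊢
    rw [← ih]
    ring

lemma tprod_one_sub_pow_roots {q ζ : ℂ} (hq : ‖q‖ < 1) (hζ : ζ ^ 4 + ζ ^ 3 + ζ ^ 2 + ζ + 1 = 0) :
    ∏' i : ℕ, (1 - (q ^ 5) ^ (i + 1)) =
      (∏' i : ℕ, (1 - q ^ (i + 1))) * (∏' i : ℕ, (1 - ζ * q * q ^ i))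
        * (∏' i : ℕ, (1 - ζ ^ 2 * q * q ^ i)) * (∏' i : ℕ, (1 - ζ ^ 3 * q * q ^ i))
        * ∏' i : ℕ, (1 - ζ ^ 4 * q * q ^ i) := by
  have hq5 : ‖q ^ 5‖ < 1 := by rw [norm_pow]; exact pow_lt_one₀ (norm_nonneg q) hq (by norm_num)
  have t (x : ℂ) := (multipliable_one_sub_mul_pow hq x).hasProd.tendsto_prod_nat
  have h := ((((tendsto_qFactorial hq).mul (t (ζ * q))).mul (t (ζ ^ 2 * q))).mul
    (t (ζ ^ 3 * q))).mul (t (ζ ^ 4 * q))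
  refine tendsto_nhds_unique (tendsto_qFactorial hq5) (h.congr fun n => ?_)
  simp only [qFactorial, ← Finset.prod_mul_distrib]
  refine Finset.prod_congr rfl fun i _ => ?_
  have key (y : ℂ) : (1 - y) * (1 - ζ * y) * (1 - ζ ^ 2 * y) * (1 - ζ ^ 3 * y) * (1 - ζ ^ 4 * y)
      = 1 - y ^ 5 := by
    have h5 : ζ ^ 5 = 1 := by linear_combination (ζ - 1) * hζ
    have e1 : (1 - ζ * y) * (1 - ζ ^ 4 * y) = 1 - (ζ + ζ ^ 4) * y + y ^ 2 := by
      linear_combination y ^ 2 * h5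
    have e2 : (1 - ζ ^ 2 * y) * (1 - ζ ^ 3 * y) = 1 + (1 + ζ + ζ ^ 4) * y + y ^ 2 := by
      linear_combination y ^ 2 * h5 - y * hζ
    have e3 : (1 - (ζ + ζ ^ 4) * y + y ^ 2) * (1 + (1 + ζ + ζ ^ 4) * y + y ^ 2) =
        1 + y + y ^ 2 + y ^ 3 + y ^ 4 := by
      grind
    calc _ = (1 - y) * (((1 - ζ * y) * (1 - ζ ^ 4 * y)) * ((1 - ζ ^ 2 * y) * (1 - ζ ^ 3 * y))) := by
          ring
      _ = _ := by
          rw [e1, e2, e3]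
          ring
  have := key (q ^ (i + 1))
  rw [← pow_mul, mul_comm 5, pow_mul, ← this, pow_succ]
  ring

/-- The coefficient of `u ^ (2 * n + 1)` in the Laurent expansion of the theta function `θ₁`. -/
def thetaCoeff (w : ℂ) (n : ℤ) : ℂ := (-1) ^ n * w ^ (n * (n + 1))

lemma thetaCoeff_neg_one_sub (w : ℂ) (n : ℤ) : thetaCoeff w (-1 - n) = -thetaCoeff w n := by
  have h : (-1 : ℂ) ^ (-1 - n) = -(-1) ^ n := by
    rw [zpow_sub₀ (by norm_num)]
    rcases Int.even_or_odd n with hn | hn <;> simp [hn.neg_one_zpow]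
  rw [thetaCoeff, thetaCoeff, h]
  ring_nf

lemma thetaCoeff_mul_zpow {w u : ℂ} (hw0 : w ≠ 0) (hu : u ≠ 0) (n : ℤ) :
    thetaCoeff w n * u ^ (2 * n + 1) = (-1) ^ n * w ^ (n * (n - 1)) * (w ^ 2 * u ^ 2) ^ n * u := by
  rw [thetaCoeff, mul_zpow, ← zpow_natCast w, ← zpow_natCast u, ← zpow_mul, ← zpow_mul,
    zpow_add_one₀ hu, show n * (n + 1) = n * (n - 1) + (2 : ℕ) * n by push_cast; ring,
    zpow_add₀ hw0]
  push_cast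
  ring

lemma theta1_eq_tsum (z τ : ℂ) :
    theta1 z τ = -I * cexp (piC * I * τ / 4) *
      ∑' n : ℤ, thetaCoeff (cexp (piC * I * τ)) n * cexp (I * z) ^ (2 * n + 1) := by
  rw [theta1]
  congr 2
  funext n
  rw [thetaCoeff, ← Complex.exp_int_mul, ← Complex.exp_int_mul]
  push_cast
  ring_nf

lemma summable_thetaCoeff_mul_zpow {w u : ℂ} (hw0 : w ≠ 0) (hw : ‖w‖ < 1) (hu : u ≠ 0) :
    Summable fun n : ℤ => thetaCoeff w n * u ^ (2 * n + 1) := by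
  have h := (summable_zpow_mul_zpow hw0 hw
    (mul_ne_zero (pow_ne_zero 2 hw0) (pow_ne_zero 2 hu))).norm.mul_right ‖u‖
  refine Summable.of_norm (h.congr fun n => ?_)
  rw [thetaCoeff_mul_zpow hw0 hu, mul_assoc ((-1 : ℂ) ^ n), norm_mul _ u, norm_mul ((-1 : ℂ) ^ n)]
  simp

lemma tsum_thetaCoeff_eq_tprod {w u : ℂ} (hw0 : w ≠ 0) (hw : ‖w‖ < 1) (hu : u ≠ 0) :
    ∑' n : ℤ, thetaCoeff w n * u ^ (2 * n + 1) =
      (u - u⁻¹) * (∏' i : ℕ, (1 - (w ^ 2) ^ (i + 1)))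
        * (∏' i : ℕ, (1 - u ^ 2 * w ^ 2 * (w ^ 2) ^ i))
        * ∏' i : ℕ, (1 - u⁻¹ ^ 2 * w ^ 2 * (w ^ 2) ^ i) := by
  have hq : ‖w ^ 2‖ < 1 := by rw [norm_pow]; exact pow_lt_one₀ (norm_nonneg w) hw two_ne_zero
  have hx : w ^ 2 * u ^ 2 ≠ 0 := mul_ne_zero (pow_ne_zero 2 hw0) (pow_ne_zero 2 hu)
  have hd : w ^ 2 / (w ^ 2 * u ^ 2) = u⁻¹ ^ 2 := by field_simp
  simp_rw [thetaCoeff_mul_zpow hw0 hu]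
  rw [tsum_mul_right, jacobi_triple_product hw0 hw hx, hd, tprod_one_sub_mul_pow_eq hq (u⁻¹ ^ 2),
    mul_comm (w ^ 2) (u ^ 2)]
  field_simp

/-- The part of the theta coefficients with index congruent to `r` modulo `5`. -/
def thetaResidue (w : ℂ) (r : ℤ) : ℂ := ∑' m : ℤ, thetaCoeff w (m * 5 + r)

lemma thetaResidue_four_sub (w : ℂ) (r : ℤ) : thetaResidue w (4 - r) = -thetaResidue w r := by
  rw [thetaResidue, thetaResidue, ← tsum_neg, ← (Equiv.subLeft (-1 : ℤ)).tsum_eq]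
  refine tsum_congr fun m => ?_
  rw [← thetaCoeff_neg_one_sub, Equiv.subLeft_apply]
  congr 1
  ring

lemma tsum_thetaCoeff_dissection {w u : ℂ} (hw0 : w ≠ 0) (hw : ‖w‖ < 1) (hu : u ≠ 0)
    (hu10 : u ^ 10 = 1) :
    ∑' n : ℤ, thetaCoeff w n * u ^ (2 * n + 1) =
      thetaResidue w 0 * (u - u ^ 9) + thetaResidue w 1 * (u ^ 3 - u ^ 7) := by
  have hs := summable_thetaCoeff_mul_zpow hw0 hw hu
  obtain ⟨e, he⟩ : ∃ e : Fin 5 × ℤ ≃ ℤ, ∀ r m, e (r, m) = m * 5 + (r : ℕ) :=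
    ⟨(Equiv.prodComm _ _).trans (Int.divModEquiv 5).symm, fun _ _ => rfl⟩
  have hs' : Summable fun p => thetaCoeff w (e p) * u ^ (2 * e p + 1) := e.summable_iff.mpr hs
  rw [← e.tsum_eq, hs'.tsum_prod, tsum_fintype]
  have key (r : Fin 5) : ∑' m : ℤ, thetaCoeff w (e (r, m)) * u ^ (2 * e (r, m) + 1)
      = thetaResidue w (r : ℕ) * u ^ (2 * (r : ℕ) + 1) := by
    rw [thetaResidue, ← tsum_mul_right]
    refine tsum_congr fun m => ?_
    have hz : u ^ (2 * (m * 5 + (r : ℕ)) + 1) = u ^ (2 * (r : ℕ) + 1) := by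
      rw [show 2 * (m * 5 + ((r : ℕ) : ℤ)) + 1 = (10 : ℕ) * m + ((2 * (r : ℕ) + 1 : ℕ) : ℤ) by
        push_cast; ring, zpow_add₀ hu, zpow_mul, zpow_natCast, hu10, one_zpow, one_mul,
        zpow_natCast]
    rw [he, hz]
  simp_rw [key]
  have h2 := thetaResidue_four_sub w 2
  have h3 := thetaResidue_four_sub w 1
  have h4 := thetaResidue_four_sub w 0
  norm_num at h2 h3 h4
  simp only [Fin.sum_univ_five]
  norm_num
  linear_combination u ^ 5 / 2 * h2 + u ^ 7 * h3 + u ^ 9 * h4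

lemma thetaResidue_zero {w : ℂ} (hw0 : w ≠ 0) (hw : ‖w‖ < 1) :
    thetaResidue w 0 = (∏' i : ℕ, (1 - (w ^ 50) ^ (i + 1))) * (∏' i : ℕ, (1 - w ^ 30 * (w ^ 50) ^ i))
        * ∏' i : ℕ, (1 - w ^ 20 * (w ^ 50) ^ i) := by
  have hw25 : ‖w ^ 25‖ < 1 := by rw [norm_pow]; exact pow_lt_one₀ (norm_nonneg w) hw (by norm_num)
  have h := jacobi_triple_product (pow_ne_zero 25 hw0) hw25 (pow_ne_zero 30 hw0)
  rw [← pow_mul, show w ^ (25 * 2) / w ^ 30 = w ^ 20 by field_simp] at h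
  refine Eq.trans (tsum_congr fun m => ?_) h
  have h1 : (-1 : ℂ) ^ (m * 5 + 0) = (-1) ^ m := by
    rcases Int.even_or_odd m with hm | hm
    · rw [hm.neg_one_zpow, Even.neg_one_zpow (by grind)]
    · rw [hm.neg_one_zpow, Odd.neg_one_zpow (by grind)]
  rw [thetaCoeff, h1, mul_assoc, ← zpow_natCast, ← zpow_natCast, ← zpow_mul, ← zpow_mul,
    ← zpow_add₀ hw0]
  congr 2
  push_cast
  ring

lemma thetaResidue_one {w : ℂ} (hw0 : w ≠ 0) (hw : ‖w‖ < 1) :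
    thetaResidue w 1 = -w ^ 2 * ((∏' i : ℕ, (1 - (w ^ 50) ^ (i + 1)))
      * (∏' i : ℕ, (1 - w ^ 40 * (w ^ 50) ^ i)) * ∏' i : ℕ, (1 - w ^ 10 * (w ^ 50) ^ i)) := by
  have hw25 : ‖w ^ 25‖ < 1 := by rw [norm_pow]; exact pow_lt_one₀ (norm_nonneg w) hw (by norm_num)
  have h := jacobi_triple_product (pow_ne_zero 25 hw0) hw25 (pow_ne_zero 40 hw0)
  rw [← pow_mul, show w ^ (25 * 2) / w ^ 40 = w ^ 10 by field_simp] at h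
  rw [← h, ← tsum_mul_left]
  refine tsum_congr fun m => ?_
  have h1 : (-1 : ℂ) ^ (m * 5 + 1) = -(-1) ^ m := by
    rcases Int.even_or_odd m with hm | hm
    · rw [hm.neg_one_zpow, Odd.neg_one_zpow (by grind)]
    · rw [hm.neg_one_zpow, Even.neg_one_zpow (by grind)]; simp
  have h2 : w ^ ((m * 5 + 1) * (m * 5 + 1 + 1)) =
      w ^ 2 * ((w ^ 25) ^ (m * (m - 1)) * (w ^ 40) ^ m) := by
    rw [← zpow_natCast w 25, ← zpow_natCast w 40, ← zpow_natCast w 2, ← zpow_mul, ← zpow_mul,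
      ← zpow_add₀ hw0, ← zpow_add₀ hw0]
    congr 1
    push_cast
    ring
  rw [thetaCoeff, h1, h2]
  ring

lemma thetaResidue_zero_mul_one {w : ℂ} (hw0 : w ≠ 0) (hw : ‖w‖ < 1) :
    thetaResidue w 0 * thetaResidue w 1 =
      -w ^ 2 * (∏' i : ℕ, (1 - (w ^ 10) ^ (i + 1))) * ∏' i : ℕ, (1 - (w ^ 50) ^ (i + 1)) := by
  have hw10 : ‖w ^ 10‖ < 1 := by rw [norm_pow]; exact pow_lt_one₀ (norm_nonneg w) hw (by norm_num)
  have h := tprod_one_sub_pow_residues hw10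
  rw [← pow_mul w 10 5, ← pow_mul w 10 2, ← pow_mul w 10 3, ← pow_mul w 10 4] at h
  norm_num only at h
  rw [thetaResidue_zero hw0 hw, thetaResidue_one hw0 hw, h]
  ring

theorem statement18 (τ : ℂ) (hτ : 0 < τ.im) :
    theta1 (2 * piC / 5) τ / theta1 (piC / 5) τ
      - theta1 (piC / 5) τ / theta1 (2 * piC / 5) τ =
    1 + 5 * eta (25 * τ) / eta τ := by
  set w := cexp (piC * I * τ) with hw_def
  have hw0 : w ≠ 0 := Complex.exp_ne_zero _
  have hw : ‖w‖ < 1 := by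
    rw [hw_def, Complex.norm_exp, Real.exp_lt_one_iff]
    simpa [piC] using mul_pos Real.pi_pos hτ
  have hq : ‖w ^ 2‖ < 1 := by rw [norm_pow]; exact pow_lt_one₀ (norm_nonneg w) hw two_ne_zero
  have hq10 : ‖w ^ 10‖ < 1 := by rw [norm_pow]; exact pow_lt_one₀ (norm_nonneg w) hw (by norm_num)
  set u := cexp (I * (piC / 5)) with hu_def
  have hu0 : u ≠ 0 := Complex.exp_ne_zero _
  have hu5 : u ^ 5 = -1 := by
    rw [hu_def, ← Complex.exp_nat_mul, ← Complex.exp_pi_mul_I, piC]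
    congr 1
    push_cast
    ring
  have hu1 : u + 1 ≠ 0 := by
    have hprim := Complex.isPrimitiveRoot_exp 10 (by norm_num)
    have hu : cexp (2 * Real.pi * I / (10 : ℕ)) = u := by
      rw [hu_def, piC]
      congr 1
      push_cast
      ring
    rw [hu] at hprim
    intro h
    exact hprim.pow_ne_one_of_pos_of_lt (l := 2) (by norm_num) (by norm_num)
      (by linear_combination (u - 1) * h)
  have hmin : u ^ 4 - u ^ 3 + u ^ 2 - u + 1 = 0 :=
    mul_left_cancel₀ hu1 (by linear_combination hu5)
  have hu10 : u ^ 10 = 1 := by linear_combination (u ^ 5 - 1) * hu5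
  have hinv : u⁻¹ = -u ^ 4 := by
    exact inv_eq_of_mul_eq_one_right (by linear_combination -hu5)
  have hu2 : cexp (I * (2 * piC / 5)) = u ^ 2 := by
    rw [hu_def, ← Complex.exp_nat_mul]
    congr 1
    push_cast
    ring
  set a := ∑' n : ℤ, thetaCoeff w n * u ^ (2 * n + 1) with ha
  set b := ∑' n : ℤ, thetaCoeff w n * (u ^ 2) ^ (2 * n + 1) with hb
  set s := u + u ^ 4 with hs
  set t := u ^ 2 + u ^ 3 with ht
  have hst : t ^ 2 - s ^ 2 = s * t := by grind
  have hst5 : (s * t) ^ 2 = 5 := by grind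
  have ha' : a = thetaResidue w 0 * s + thetaResidue w 1 * t := by
    rw [ha, tsum_thetaCoeff_dissection hw0 hw hu0 hu10]
    have e9 : u ^ 9 = -u ^ 4 := by linear_combination u ^ 4 * hu5
    have e7 : u ^ 7 = -u ^ 2 := by linear_combination u ^ 2 * hu5
    rw [e9, e7]
    ring
  have hb' : b = thetaResidue w 0 * t - thetaResidue w 1 * s := by
    rw [hb, tsum_thetaCoeff_dissection hw0 hw (pow_ne_zero 2 hu0) (by rw [pow_right_comm, hu10, one_pow])]
    have e18 : (u ^ 2) ^ 9 = -u ^ 3 := by linear_combination (u ^ 13 - u ^ 8 + u ^ 3) * hu5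
    have e6 : (u ^ 2) ^ 3 = -u := by linear_combination u * hu5
    have e14 : (u ^ 2) ^ 7 = u ^ 4 := by linear_combination (u ^ 9 - u ^ 4) * hu5
    rw [e18, e6, e14]
    ring
  set P := ∏' i : ℕ, (1 - (w ^ 2) ^ (i + 1)) with hP
  set P5 := ∏' i : ℕ, (1 - (w ^ 10) ^ (i + 1)) with hP5
  set P25 := ∏' i : ℕ, (1 - (w ^ 50) ^ (i + 1)) with hP25
  have hP0 : P ≠ 0 := tprod_one_sub_pow_ne_zero hq
  have hP50 : P5 ≠ 0 := tprod_one_sub_pow_ne_zero hq10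
  have hab : a * b = s * t * P * P5 := by
    have h := tprod_one_sub_pow_roots (ζ := u ^ 2) hq
      (by linear_combination (u ^ 4 + u ^ 3 + u ^ 2 + u + 1) * hmin)
    rw [← pow_mul, show 2 * 5 = 10 by norm_num] at h
    rw [hP5, h, ha, hb, tsum_thetaCoeff_eq_tprod hw0 hw hu0,
      tsum_thetaCoeff_eq_tprod hw0 hw (pow_ne_zero 2 hu0), ← inv_pow, hinv]
    have e1 : (-u ^ 4) ^ 2 = (u ^ 2) ^ 4 := by ring
    have e2 : ((-u ^ 4) ^ 2) ^ 2 = (u ^ 2) ^ 3 := by linear_combination u ^ 6 * hu10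
    have e3 : u ^ 2 - (u ^ 2) ^ 4 = t := by rw [ht]; linear_combination -u ^ 3 * hu5
    rw [e2, e1, e3]
    ring
  have hres := thetaResidue_zero_mul_one hw0 hw
  have hmain : b ^ 2 - a ^ 2 = a * b + 5 * (s * t) * w ^ 2 * P5 * P25 := by
    rw [ha', hb']
    linear_combination (thetaResidue w 0 ^ 2 - thetaResidue w 1 ^ 2 -
      thetaResidue w 0 * thetaResidue w 1) * hst - 5 * (s * t) * hres
  have hst0 : s * t ≠ 0 := fun h => by norm_num [h] at hst5
  have hab0 : a * b ≠ 0 := by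
    rw [hab]
    exact mul_ne_zero (mul_ne_zero hst0 hP0) hP50
  have ha0 : a ≠ 0 := left_ne_zero_of_mul hab0
  have hb0 : b ≠ 0 := right_ne_zero_of_mul hab0
  have heta : eta (25 * τ) / eta τ = w ^ 2 * P25 / P := by
    have h1 : qq τ = w ^ 2 := by
      rw [qq, hw_def, ← Complex.exp_nat_mul]; congr 1; push_cast; ring
    have h2 : qq (25 * τ) = w ^ 50 := by
      rw [qq, hw_def, ← Complex.exp_nat_mul]; congr 1; push_cast; ring
    have h3 : cexp (piC * I * (25 * τ) / 12) = cexp (piC * I * τ / 12) * w ^ 2 := by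
      rw [hw_def, ← Complex.exp_nat_mul, ← Complex.exp_add]; congr 1; push_cast; ring
    have h4 := Complex.exp_ne_zero (piC * I * τ / 12)
    rw [eta, eta, h1, h2, h3, ← hP, ← hP25]
    field_simp
  have hK : -I * cexp (piC * I * τ / 4) ≠ 0 :=
    mul_ne_zero (neg_ne_zero.mpr I_ne_zero) (Complex.exp_ne_zero _)
  rw [theta1_eq_tsum, theta1_eq_tsum, hu2, ← hw_def, ← hu_def, ← ha, ← hb, mul_div_mul_left _ _ hK,
    mul_div_mul_left _ _ hK, mul_div_assoc, heta]
  have e : b / a - a / b = (b ^ 2 - a ^ 2) / (a * b) := by field_simp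
  have hs0 : s ≠ 0 := left_ne_zero_of_mul hst0
  have ht0 : t ≠ 0 := right_ne_zero_of_mul hst0
  rw [e, hmain, add_div, div_self hab0, hab]
  field_simp
end Liu
end
end
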